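/- Let h : ℝ^l → ℝ be a differentiable convex function and L > 0. If ∇h is Lipschitz continuous with constant L, i.e., ‖∇h(x) − ∇h(x')‖₂ ≤ L‖x − x'‖₂ for all x, x' ∈ ℝ^l, then ∇h is cocoercive with constant 1/L, i.e., ‖∇h(x) − ∇h(x')‖₂² ≤ L·(x − x')ᵀ(∇h(x) − ∇h(x')) for all x, x' ∈ ℝ^l. -/

import Mathlib

open RealInnerProductSpace

section GradientInequalities

variable {F : Type*} [NormedAddCommGroup F] [InnerProductSpace ℝ F] [CompleteSpace F]

theorem Differentiable.hasDerivAt_gradient_line {f : F → ℝ} (hf : Differentiable ℝ f)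
    (x v : F) (t : ℝ) :
    HasDerivAt (fun s : ℝ => f (x + s • v)) ⟪gradient f (x + t • v), v⟫ t := by
  have hline : HasDerivAt (fun s : ℝ => x + s • v) v t := by
    simpa using ((hasDerivAt_id t).smul_const v).const_add x
  rw [inner_gradient_left]
  exact (hf (x + t • v)).hasFDerivAt.comp_hasDerivAt t hline

/-- A differentiable convex function lies above its tangent hyperplanes. -/
theorem ConvexOn.add_inner_gradient_le {f : F → ℝ} (hconv : ConvexOn ℝ Set.univ f)
    (hf : Differentiable ℝ f) (x v : F) : f x + ⟪gradient f x, v⟫ ≤ f (x + v) := by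
  have hline : ConvexOn ℝ Set.univ (fun s : ℝ => f (x + s • v)) := by
    refine ⟨convex_univ, fun a _ b _ p q hp hq hpq => ?_⟩
    have hcomb : x + (p • a + q • b) • v = p • (x + a • v) + q • (x + b • v) := by
      obtain rfl : q = 1 - p := by linarith
      simp only [smul_eq_mul]
      module
    simpa only [hcomb] using hconv.2 (Set.mem_univ (x + a • v)) (Set.mem_univ (x + b • v)) hp hq hpq
  have hslope := hline.le_slope_of_hasDerivAt (Set.mem_univ 0) (Set.mem_univ 1) one_pos
    (hf.hasDerivAt_gradient_line x v 0)
  simp only [slope_def_field, zero_smul, one_smul, add_zero, sub_zero, div_one] at hslope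
  linarith

/-- The descent lemma: a function with `L`-Lipschitz gradient lies below the quadratic
`f x + ⟪gradient f x, v⟫ + L / 2 * ‖v‖ ^ 2`. -/
theorem Differentiable.le_add_inner_gradient_add_sq {f : F → ℝ} {L : ℝ}
    (hf : Differentiable ℝ f)
    (hlip : ∀ x y : F, ‖gradient f x - gradient f y‖ ≤ L * ‖x - y‖) (x v : F) :
    f (x + v) ≤ f x + ⟪gradient f x, v⟫ + L / 2 * ‖v‖ ^ 2 := by
  have hderiv (t : ℝ) : HasDerivAt
      (fun s : ℝ => f (x + s • v) - s * ⟪gradient f x, v⟫ - s ^ 2 * (L / 2 * ‖v‖ ^ 2))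
      (⟪gradient f (x + t • v), v⟫ - ⟪gradient f x, v⟫ - t * (L * ‖v‖ ^ 2)) t := by
    refine (((hf.hasDerivAt_gradient_line x v t).sub
      ((hasDerivAt_id t).mul_const ⟪gradient f x, v⟫)).sub
      ((hasDerivAt_pow 2 t).mul_const (L / 2 * ‖v‖ ^ 2))).congr_deriv ?_
    simp
    ring
  have hanti := antitoneOn_of_hasDerivWithinAt_nonpos (convex_Icc (0 : ℝ) 1)
    (fun t _ => (hderiv t).continuousAt.continuousWithinAt)
    (fun t _ => (hderiv t).hasDerivWithinAt) (fun t ht => by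
      have ht0 : 0 ≤ t := (interior_subset ht).1
      have hgrad := hlip (x + t • v) x
      rw [add_sub_cancel_left, norm_smul, Real.norm_of_nonneg ht0] at hgrad
      have hcs := real_inner_le_norm (gradient f (x + t • v) - gradient f x) v
      rw [inner_sub_left] at hcs
      nlinarith [mul_le_mul_of_nonneg_right hgrad (norm_nonneg v)])
  have hends := hanti (Set.left_mem_Icc.2 zero_le_one) (Set.right_mem_Icc.2 zero_le_one)
    zero_le_one
  simp only [zero_smul, one_smul, add_zero, zero_mul, one_mul, sub_zero, one_pow, ne_eq,
    OfNat.ofNat_ne_zero, not_false_eq_true, zero_pow] at hends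
  linarith

theorem ConvexOn.add_inner_gradient_add_sq_le {f : F → ℝ} {L : ℝ}
    (hconv : ConvexOn ℝ Set.univ f) (hL : 0 < L) (hf : Differentiable ℝ f)
    (hlip : ∀ x y : F, ‖gradient f x - gradient f y‖ ≤ L * ‖x - y‖) (x y : F) :
    f x + ⟪gradient f x, y - x⟫ + 1 / (2 * L) * ‖gradient f x - gradient f y‖ ^ 2 ≤ f y := by
  set d := gradient f x - gradient f y with hd
  have hlower := hconv.add_inner_gradient_le hf x (y - x + L⁻¹ • d)
  have hupper := hf.le_add_inner_gradient_add_sq hlip y (L⁻¹ • d)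
  rw [← add_assoc, add_sub_cancel, inner_add_right, inner_smul_right] at hlower
  rw [inner_smul_right, norm_smul, Real.norm_of_nonneg (inv_nonneg.2 hL.le)] at hupper
  have hinner : ⟪gradient f x, d⟫ - ⟪gradient f y, d⟫ = ‖d‖ ^ 2 := by
    rw [← inner_sub_left, ← hd, real_inner_self_eq_norm_sq]
  have hscaled : L⁻¹ * ⟪gradient f x, d⟫ - L⁻¹ * ⟪gradient f y, d⟫ = L⁻¹ * ‖d‖ ^ 2 := by
    rw [← mul_sub, hinner]
  have hquad : L / 2 * (L⁻¹ * ‖d‖) ^ 2 = 1 / (2 * L) * ‖d‖ ^ 2 := by field_simp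
  have hhalf : L⁻¹ * ‖d‖ ^ 2 = 2 * (1 / (2 * L) * ‖d‖ ^ 2) := by field_simp
  linarith

end GradientInequalities

/-- Lemma 1, (1) ⇒ (2): for a differentiable convex function, Lipschitz continuity of the
gradient with constant `L` implies cocoercivity of the gradient with constant `1/L`. -/
theorem lipschitz_grad_implies_cocoercive {l : ℕ} (h : EuclideanSpace ℝ (Fin l) → ℝ) (L : ℝ)
    (hL : 0 < L) (hdiff : Differentiable ℝ h) (hconv : ConvexOn ℝ Set.univ h)
    (hlip : ∀ x x' : EuclideanSpace ℝ (Fin l), ‖gradient h x - gradient h x'‖ ≤ L * ‖x - x'‖) :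
    ∀ x x' : EuclideanSpace ℝ (Fin l),
      ‖gradient h x - gradient h x'‖ ^ 2 ≤ L * ⟪x - x', gradient h x - gradient h x'⟫ := by
  intro x y
  have hxy := hconv.add_inner_gradient_add_sq_le hL hdiff hlip x y
  have hyx := hconv.add_inner_gradient_add_sq_le hL hdiff hlip y x
  rw [norm_sub_rev] at hyx
  have hinner : ⟪x - y, gradient h x - gradient h y⟫
      = -⟪gradient h x, y - x⟫ - ⟪gradient h y, x - y⟫ := by
    rw [← neg_sub x y, inner_neg_right, neg_neg, ← inner_sub_left, real_inner_comm]
  have hsum : L⁻¹ * ‖gradient h x - gradient h y‖ ^ 2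
      = 2 * (1 / (2 * L) * ‖gradient h x - gradient h y‖ ^ 2) := by field_simp
  rw [← inv_mul_le_iff₀ hL]
  linarith
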